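/- Let H = {0, 89, 178, 267, 356, 445, 534} ⊆ ℤ/623ℤ and let B = {0, 1, 3, 118, 304, 350, 398, 435} ⊆ ℤ/623ℤ. Then H is a subgroup of ℤ/623ℤ of order 7, and the eleven difference sets Δ(8ⁱ·B) for i = 0, 1, …, 10 are pairwise disjoint, each has cardinality 56, each is disjoint from H, and their union together with H \ {0} is (ℤ/623ℤ) \ {0}. -/

import Mathlib

/-- The set of differences `ΔB = {a - c : a, c ∈ B, a ≠ c}`. -/
def diffSet (B : Finset (ZMod 623)) : Finset (ZMod 623) :=
  ((B ×ˢ B).filter fun p => p.1 ≠ p.2).image fun p => p.1 - p.2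

/-- The subgroup block `H = {0, 89, 178, 267, 356, 445, 534}` of `ℤ/623ℤ`. -/
def Hblock : Finset (ZMod 623) := {0, 89, 178, 267, 356, 445, 534}

/-- The base block `B`. -/
def baseBlock : Finset (ZMod 623) := {0, 1, 3, 118, 304, 350, 398, 435}

/-- The dilates `8ⁱ · B` of the base block, for `i = 0, 1, …, 10`. -/
def dilate (i : Fin 11) : Finset (ZMod 623) :=
  baseBlock.image fun x => (8 : ZMod 623) ^ (i : ℕ) * x

theorem eight_pow_eleven : (8 : ZMod 623) ^ 11 = 1 := by decide

theorem isUnit_eight_pow (n : ℕ) : IsUnit ((8 : ZMod 623) ^ n) :=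
  (IsUnit.of_pow_eq_one eight_pow_eleven (by norm_num)).pow n

theorem diffSet_image_mul {u : ZMod 623} (hu : IsUnit u) (B : Finset (ZMod 623)) :
    diffSet (B.image fun x => u * x) = (diffSet B).image fun x => u * x := by
  ext z
  simp only [diffSet, Finset.mem_image, Finset.mem_filter, Finset.mem_product, Prod.exists]
  constructor
  · rintro ⟨_, _, ⟨⟨⟨a, ha, rfl⟩, c, hc, rfl⟩, hne⟩, rfl⟩
    exact ⟨a - c, ⟨a, c, ⟨⟨ha, hc⟩, fun h => hne (congrArg (u * ·) h)⟩, rfl⟩, mul_sub u a c⟩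
  · rintro ⟨_, ⟨a, c, ⟨⟨ha, hc⟩, hne⟩, rfl⟩, rfl⟩
    exact ⟨u * a, u * c, ⟨⟨⟨a, ha, rfl⟩, c, hc, rfl⟩, fun h => hne (hu.mul_left_cancel h)⟩,
      (mul_sub u a c).symm⟩

theorem diffSet_dilate (i : Fin 11) :
    diffSet (dilate i) = (diffSet baseBlock).image fun x => (8 : ZMod 623) ^ (i : ℕ) * x :=
  diffSet_image_mul (isUnit_eight_pow i) baseBlock

theorem card_diffSet_baseBlock : (diffSet baseBlock).card = 56 := by
  decide +kernel

/-- The map `x ↦ x ^ 11` is constant on the orbits of multiplication by `8`, and it separates the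
differences of the base block. -/
theorem pow_eleven_injOn_diffSet_baseBlock :
    Set.InjOn (fun x : ZMod 623 => x ^ 11) (diffSet baseBlock) := by
  have h : ((diffSet baseBlock).image fun x => x ^ 11).card = 56 := by decide +kernel
  exact Finset.card_image_iff.mp (h.trans card_diffSet_baseBlock.symm)

theorem mem_Hblock_iff (x : ZMod 623) : x ∈ Hblock ↔ 7 * x = 0 := by
  revert x
  decide +kernel

theorem seven_mul_ne_zero_of_mem_diffSet_baseBlock :
    ∀ x ∈ diffSet baseBlock, 7 * x ≠ 0 := by
  decide +kernel

theorem eight_pow_mul_injective {x : ZMod 623} (hx : 7 * x ≠ 0) :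
    Function.Injective fun i : Fin 11 => (8 : ZMod 623) ^ (i : ℕ) * x := by
  have key : ∀ i j : Fin 11, i ≠ j →
      ∃ v : Fin 89, (v.val : ZMod 623) * (7 * (8 ^ (i : ℕ) - 8 ^ (j : ℕ))) = 7 * 7 := by
    decide +kernel
  intro i j hij
  by_contra hne
  obtain ⟨v, hv⟩ := key i j hne
  have h49 : (7 * 7 : ZMod 623) * x = 0 := by
    rw [← hv]
    linear_combination (v.val : ZMod 623) * 7 * hij
  have h7 : (89 : ZMod 623) * (7 * x) = 0 := by
    rw [← mul_assoc, show (89 * 7 : ZMod 623) = 0 by decide, zero_mul]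
  apply hx
  linear_combination 3 * h7 - 38 * h49

theorem disjoint_diffSet_dilate {i j : Fin 11} (hij : i ≠ j) :
    Disjoint (diffSet (dilate i)) (diffSet (dilate j)) := by
  rw [diffSet_dilate, diffSet_dilate, Finset.disjoint_left]
  intro z hi hj
  obtain ⟨x, hx, rfl⟩ := Finset.mem_image.mp hi
  obtain ⟨y, hy, hyx⟩ := Finset.mem_image.mp hj
  have hpow (k : ℕ) (w : ZMod 623) : (8 ^ k * w) ^ 11 = w ^ 11 := by
    rw [mul_pow, pow_right_comm, eight_pow_eleven, one_pow, one_mul]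
  have hxy : y = x := pow_eleven_injOn_diffSet_baseBlock hy hx <|
    (hpow j y).symm.trans ((congrArg (· ^ 11) hyx).trans (hpow i x))
  subst hxy
  exact hij (eight_pow_mul_injective (seven_mul_ne_zero_of_mem_diffSet_baseBlock y hy) hyx.symm)

theorem card_diffSet_dilate (i : Fin 11) : (diffSet (dilate i)).card = 56 := by
  rw [diffSet_dilate, Finset.card_image_of_injective _ (isUnit_eight_pow i).mul_right_injective,
    card_diffSet_baseBlock]

theorem disjoint_diffSet_dilate_Hblock (i : Fin 11) :
    Disjoint (diffSet (dilate i)) Hblock := by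
  rw [diffSet_dilate, Finset.disjoint_left]
  intro z hz hH
  obtain ⟨x, hx, rfl⟩ := Finset.mem_image.mp hz
  rw [mem_Hblock_iff, mul_left_comm, (isUnit_eight_pow i).mul_right_eq_zero] at hH
  exact seven_mul_ne_zero_of_mem_diffSet_baseBlock x hx hH

theorem card_Hblock : Hblock.card = 7 := by decide

theorem Hblock_union_biUnion_diffSet_dilate :
    Hblock ∪ (Finset.univ.biUnion fun i => diffSet (dilate i)) = Finset.univ := by
  rw [← Finset.card_eq_iff_eq_univ, Finset.card_union_of_disjoint, Finset.card_biUnion]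
  · simp only [card_diffSet_dilate, card_Hblock, Finset.sum_const, Finset.card_univ,
      Fintype.card_fin, ZMod.card, smul_eq_mul]
  · exact fun i _ j _ hij => disjoint_diffSet_dilate hij
  · exact (Finset.disjoint_biUnion_right _ _ _).mpr fun i _ =>
      (disjoint_diffSet_dilate_Hblock i).symm

/-- `H` is a subgroup of `ℤ/623ℤ` of order `7`, and the eleven difference sets
`Δ(8ⁱ · B)`, `i = 0, …, 10`, are pairwise disjoint, each has cardinality `56`,
each is disjoint from `H`, and their union together with `H \ {0}` is
`ℤ/623ℤ \ {0}`. -/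
theorem one_rotational_difference_family_zmod_623_11 :
    (∃ S : AddSubgroup (ZMod 623), (S : Set (ZMod 623)) = (Hblock : Set (ZMod 623))) ∧
    Hblock.card = 7 ∧
    (∀ i j, i ≠ j → Disjoint (diffSet (dilate i)) (diffSet (dilate j))) ∧
    (∀ i, (diffSet (dilate i)).card = 56) ∧
    (∀ i, Disjoint (diffSet (dilate i)) Hblock) ∧
    (Hblock \ {0}) ∪ (Finset.univ.biUnion fun i => diffSet (dilate i)) =
      Finset.univ \ {0} := by
  refine ⟨⟨(AddMonoidHom.mulLeft (7 : ZMod 623)).ker, ?_⟩, card_Hblock,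
    fun _ _ => disjoint_diffSet_dilate, card_diffSet_dilate, disjoint_diffSet_dilate_Hblock, ?_⟩
  · ext x
    simp [mem_Hblock_iff, AddMonoidHom.mem_ker]
  · have h0 : (0 : ZMod 623) ∉ Finset.univ.biUnion fun i => diffSet (dilate i) := by
      simp [diffSet, sub_eq_zero]
    rw [← Hblock_union_biUnion_diffSet_dilate, Finset.union_sdiff_distrib,
      Finset.sdiff_singleton_eq_erase _ (Finset.univ.biUnion _), Finset.erase_eq_of_notMem h0]
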